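/- Let q be a prime power, m, n positive integers with n ≤ m, g_1, …, g_n ∈ F_{q^m} linearly independent over F_q, and 1 ≤ k < n. For every q-linearized polynomial f over F_{q^m} with deg_q(f) = k, the word σ_f = (f(g_1), …, f(g_n)) satisfies d_R(σ_f, G) = n − k; consequently there are at least (q^m − 1)·q^{mk} words u ∈ F_{q^m}^n with d_R(u, G) = n − k. -/

import Mathlib

def gabidulinCode (q : ℕ) {F : Type} [Field F] {n : ℕ} (g : Fin n → F) (k : ℕ) :
    Set (Fin n → F) :=
  {c | ∃ v : Fin k → F, c = fun j => ∑ i : Fin k, v i * g j ^ q ^ (i : ℕ)}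

noncomputable def rankDistTo (Fq : Type) [Field Fq] {F : Type} [Field F] [Algebra Fq F]
    {n : ℕ} (u : Fin n → F) (G : Set (Fin n → F)) : ℕ :=
  sInf {r : ℕ | ∃ c ∈ G, r = Module.finrank Fq (Submodule.span Fq (Set.range (u - c)))}

theorem finrank_span_range_le_sub (K : Type) [Field K] {V : Type} [AddCommGroup V] [Module K V]
    {n k : ℕ} (u : Fin n → V) (hkn : k ≤ n)
    (hu : ∀ j : Fin n, (j : ℕ) < k → u j = 0) :
    Module.finrank K (Submodule.span K (Set.range u)) ≤ n - k := by
  have hle : Submodule.span K (Set.range u) ≤ Submodule.span K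
      (Set.range fun i : Fin (n - k) => u ⟨k + i, by omega⟩) := by
    rw [Submodule.span_le]
    rintro _ ⟨j, rfl⟩
    by_cases hj : (j : ℕ) < k
    · rw [hu j hj]
      exact Submodule.zero_mem _
    · refine Submodule.subset_span ⟨⟨j - k, by omega⟩, congrArg u (Fin.ext ?_)⟩
      simp only
      omega
  have : FiniteDimensional K (Submodule.span K
      (Set.range fun i : Fin (n - k) => u ⟨k + i, by omega⟩)) :=
    FiniteDimensional.span_of_finite K (Set.finite_range _)
  refine (Submodule.finrank_mono hle).trans ?_
  simpa using! finrank_range_le_card (R := K) (fun i : Fin (n - k) => u ⟨k + i, by omega⟩)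

section LinearizedPolynomial

variable (Fq : Type) [Field Fq] [Fintype Fq] {F : Type} [Field F] [Algebra Fq F]

/-- The `Fq`-linear map `x ↦ ∑ i, w i * x ^ q ^ i` attached to a `q`-linearized polynomial with
coefficients `w`, where `q` is the cardinality of `Fq`. -/
noncomputable def linearizedMap {d : ℕ} (w : Fin d → F) : F →ₗ[Fq] F :=
  ∑ i : Fin d, LinearMap.mulLeft Fq (w i) ∘ₗ
    (FiniteField.frobeniusAlgHom Fq F ^ (i : ℕ)).toLinearMap

theorem linearizedMap_apply {d : ℕ} (w : Fin d → F) (x : F) :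
    linearizedMap Fq w x = ∑ i : Fin d, w i * x ^ Fintype.card Fq ^ (i : ℕ) := by
  simp [linearizedMap, LinearMap.sum_apply, AlgHom.coe_pow, FiniteField.coe_frobeniusAlgHom,
    pow_iterate]

theorem linearizedMap_sub {d : ℕ} (v w : Fin d → F) (x : F) :
    linearizedMap Fq (v - w) x = linearizedMap Fq v x - linearizedMap Fq w x := by
  simp [linearizedMap_apply, sub_mul]

theorem linearizedMap_castSucc {d : ℕ} (w : Fin (d + 1) → F) (x : F) :
    linearizedMap Fq w x = linearizedMap Fq (fun i : Fin d => w i.castSucc) x +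
      w (Fin.last d) * x ^ Fintype.card Fq ^ d := by
  simp [linearizedMap_apply, Fin.sum_univ_castSucc]

/-- A nonzero `q`-linearized polynomial with `d` coefficients has a root space of dimension
less than `d`. -/
theorem finrank_ker_linearizedMap_lt [Fintype F] {d : ℕ} {w : Fin d → F} (hw : w ≠ 0) :
    Module.finrank Fq (LinearMap.ker (linearizedMap Fq w)) < d := by
  classical
  have hq : 1 < Fintype.card Fq := Fintype.one_lt_card
  obtain ⟨i₀, hi₀⟩ := Function.ne_iff.mp hw
  let p : Polynomial F :=
    ∑ i : Fin d, Polynomial.C (w i) * Polynomial.X ^ Fintype.card Fq ^ (i : ℕ)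
  have hcoeff : p.coeff (Fintype.card Fq ^ (i₀ : ℕ)) = w i₀ := by
    simp only [p, Polynomial.finsetSum_coeff, Polynomial.coeff_C_mul_X_pow]
    rw [Finset.sum_eq_single i₀]
    · simp
    · intro j _ hj
      rw [if_neg]
      exact fun h => hj (Fin.ext (Nat.pow_right_injective hq h).symm)
    · simp
  have hp : p ≠ 0 := by
    intro h
    rw [h, Polynomial.coeff_zero] at hcoeff
    exact hi₀ hcoeff.symm
  have hdeg : p.natDegree ≤ Fintype.card Fq ^ (d - 1) := by
    refine Polynomial.natDegree_sum_le_of_forall_le _ _ fun i _ => ?_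
    refine (Polynomial.natDegree_C_mul_X_pow_le _ _).trans ?_
    exact Nat.pow_le_pow_right hq.le (by omega)
  have hroots : Fintype.card (LinearMap.ker (linearizedMap Fq w)) ≤ p.natDegree := by
    refine (Set.toFinset_card (LinearMap.ker (linearizedMap Fq w) : Set F)).symm.trans_le ?_
    refine Polynomial.card_le_degree_of_subset_roots fun x hx => ?_
    have hx' : linearizedMap Fq w x = 0 := by simpa using hx
    rw [Polynomial.mem_roots hp, Polynomial.IsRoot, ← hx', linearizedMap_apply]
    simp [p, Polynomial.eval_finsetSum]
  rw [Module.card_eq_pow_finrank (K := Fq)] at hroots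
  have := (Nat.pow_le_pow_iff_right hq).mp (hroots.trans hdeg)
  have := i₀.isLt
  omega

theorem finrank_span_linearizedMap [Fintype F] {d n : ℕ} {w : Fin d → F} (hw : w ≠ 0)
    {g : Fin n → F} (hg : LinearIndependent Fq g) :
    n < Module.finrank Fq
      (Submodule.span Fq (Set.range fun j => linearizedMap Fq w (g j))) + d := by
  have hspan : Submodule.span Fq (Set.range fun j => linearizedMap Fq w (g j)) =
      LinearMap.range ((linearizedMap Fq w).domRestrict (Submodule.span Fq (Set.range g))) := by
    rw [LinearMap.range_domRestrict, Submodule.map_span, ← Set.range_comp]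
    rfl
  have hker : Module.finrank Fq (LinearMap.ker
      ((linearizedMap Fq w).domRestrict (Submodule.span Fq (Set.range g)))) ≤
      Module.finrank Fq (LinearMap.ker (linearizedMap Fq w)) := by
    rw [← Submodule.finrank_map_subtype_eq]
    refine Submodule.finrank_mono ?_
    rintro _ ⟨x, hx, rfl⟩
    exact hx
  have hrn := LinearMap.finrank_range_add_finrank_ker
    ((linearizedMap Fq w).domRestrict (Submodule.span Fq (Set.range g)))
  rw [finrank_span_eq_card hg, Fintype.card_fin] at hrn
  have := finrank_ker_linearizedMap_lt Fq hw
  rw [hspan]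
  omega

theorem eq_zero_of_linearizedMap_eq_zero [Fintype F] {d n : ℕ} (hdn : d ≤ n) {w : Fin d → F}
    {g : Fin n → F} (hg : LinearIndependent Fq g) (h : ∀ j, linearizedMap Fq w (g j) = 0) :
    w = 0 := by
  by_contra hw
  have hlt := finrank_span_linearizedMap Fq hw hg
  have hbot : Submodule.span Fq (Set.range fun j => linearizedMap Fq w (g j)) = ⊥ := by
    rw [Submodule.span_eq_bot]
    rintro _ ⟨j, rfl⟩
    exact h j
  rw [hbot, finrank_bot] at hlt
  omega

/-- Interpolation by `q`-linearized polynomials at linearly independent points. -/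
theorem exists_linearizedMap_eq [Fintype F] {k : ℕ} {e : Fin k → F}
    (he : LinearIndependent Fq e) (y : Fin k → F) :
    ∃ v : Fin k → F, ∀ j, linearizedMap Fq v (e j) = y j := by
  have hinj : Function.Injective fun (v : Fin k → F) j => linearizedMap Fq v (e j) := by
    intro v w hvw
    refine sub_eq_zero.mp (eq_zero_of_linearizedMap_eq_zero Fq le_rfl he fun j => ?_)
    rw [linearizedMap_sub, sub_eq_zero]
    exact congrFun hvw j
  obtain ⟨v, hv⟩ := Finite.surjective_of_injective hinj y
  exact ⟨v, congrFun hv⟩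

theorem mem_gabidulinCode_iff {n k : ℕ} {g c : Fin n → F} :
    c ∈ gabidulinCode (Fintype.card Fq) g k ↔
      ∃ v : Fin k → F, c = fun j => linearizedMap Fq v (g j) := by
  simp only [gabidulinCode, Set.mem_ofPred_eq, linearizedMap_apply]

/-- A word given by a `q`-linearized polynomial of `q`-degree exactly `k` is a deep hole. -/
theorem rankDistTo_linearizedMap [Fintype F] {n k : ℕ} (hkn : k ≤ n) {g : Fin n → F}
    (hg : LinearIndependent Fq g) {w : Fin (k + 1) → F} (hw : w (Fin.last k) ≠ 0) :
    rankDistTo Fq (fun j => linearizedMap Fq w (g j))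
      (gabidulinCode (Fintype.card Fq) g k) = n - k := by
  have hlower : ∀ c ∈ gabidulinCode (Fintype.card Fq) g k, n - k ≤ Module.finrank Fq
      (Submodule.span Fq (Set.range ((fun j => linearizedMap Fq w (g j)) - c))) := by
    intro c hc
    obtain ⟨v, rfl⟩ := (mem_gabidulinCode_iff Fq).mp hc
    let w' : Fin (k + 1) → F :=
      Fin.snoc (α := fun _ => F) ((fun i => w i.castSucc) - v) (w (Fin.last k))
    have hw' : w' ≠ 0 := fun h => hw (by simpa [w'] using congrFun h (Fin.last k))
    have hdiff : ((fun j => linearizedMap Fq w (g j)) - fun j => linearizedMap Fq v (g j)) =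
        fun j => linearizedMap Fq w' (g j) := by
      funext j
      rw [Pi.sub_apply, linearizedMap_castSucc Fq w, linearizedMap_castSucc Fq w']
      simp only [w', Fin.snoc_castSucc, Fin.snoc_last]
      rw [linearizedMap_sub]
      ring
    have := finrank_span_linearizedMap Fq hw' hg
    rw [hdiff]
    omega
  obtain ⟨v, hv⟩ := exists_linearizedMap_eq Fq (hg.comp _ (Fin.castLE_injective hkn))
    fun j => linearizedMap Fq w (g (Fin.castLE hkn j))
  have hc : (fun j => linearizedMap Fq v (g j)) ∈ gabidulinCode (Fintype.card Fq) g k :=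
    (mem_gabidulinCode_iff Fq).mpr ⟨v, rfl⟩
  have hupper := finrank_span_range_le_sub Fq
    ((fun j => linearizedMap Fq w (g j)) - fun j => linearizedMap Fq v (g j)) hkn fun j hj => by
      rw [Pi.sub_apply, sub_eq_zero]
      exact (hv ⟨j, hj⟩).symm
  refine le_antisymm (le_trans (Nat.sInf_le (by exact ⟨_, hc, rfl⟩)) hupper) ?_
  refine le_csInf ⟨_, ⟨_, hc, rfl⟩⟩ ?_
  rintro _ ⟨c, hc, rfl⟩
  exact hlower c hc

end LinearizedPolynomial

/-- Corollary 1 (rank metric): every `σ_f` with `deg_q f = k` is at rank distance exactly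
`n - k` from the Gabidulin code, and there are at least `(q^m - 1) q^{mk}` such words. -/
theorem deep_holes_of_qdegree_k
    (q m n k : ℕ) (hq : IsPrimePow q) (hm : 0 < m) (hn : 0 < n) (hnm : n ≤ m)
    (Fq F : Type) [Field Fq] [Fintype Fq] [Field F] [Fintype F] [Algebra Fq F]
    (hcardFq : Fintype.card Fq = q) (hcardF : Fintype.card F = q ^ m)
    (g : Fin n → F) (hg : LinearIndependent Fq g)
    (hk : 1 ≤ k) (hkn : k < n) :
    (∀ a : ℕ → F, a k ≠ 0 → (∀ i, k < i → a i = 0) →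
      rankDistTo Fq (fun j => ∑ i ∈ Finset.range (k + 1), a i * g j ^ q ^ i)
        (gabidulinCode q g k) = n - k) ∧
    (q ^ m - 1) * q ^ (m * k) ≤
      {u : Fin n → F | rankDistTo Fq u (gabidulinCode q g k) = n - k}.ncard := by
  subst hcardFq
  refine ⟨fun a ha _ => ?_, ?_⟩
  · have h := rankDistTo_linearizedMap Fq hkn.le hg (w := fun i => a i) (by simpa using ha)
    simp only [linearizedMap_apply] at h
    simp only [Finset.sum_range]
    exact h
  · let word : Fˣ × (Fin k → F) → Fin n → F := fun p j =>
      linearizedMap Fq (Fin.snoc (α := fun _ => F) p.2 (p.1 : F)) (g j)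
    have hinj : Function.Injective word := by
      intro p p' h
      have hsnoc : Fin.snoc (α := fun _ => F) p.2 (p.1 : F) =
          Fin.snoc (α := fun _ => F) p'.2 (p'.1 : F) := by
        refine sub_eq_zero.mp (eq_zero_of_linearizedMap_eq_zero Fq hkn hg fun j => ?_)
        rw [linearizedMap_sub, sub_eq_zero]
        exact congrFun h j
      obtain ⟨h₂, h₁⟩ := Fin.snoc_inj.mp hsnoc
      exact Prod.ext (Units.ext h₁) h₂
    have hcard : (Set.range word).ncard =
        (Fintype.card Fq ^ m - 1) * Fintype.card Fq ^ (m * k) := by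
      classical
      rw [← Set.image_univ, Set.ncard_image_of_injective _ hinj, Set.ncard_univ,
        Nat.card_eq_fintype_card, Fintype.card_prod, Fintype.card_units, Fintype.card_fun,
        Fintype.card_fin, hcardF, pow_mul]
    rw [← hcard]
    refine Set.ncard_le_ncard ?_
    rintro _ ⟨p, rfl⟩
    exact rankDistTo_linearizedMap Fq hkn.le hg (by simp)
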